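/- arXiv:2410.00845 — 4 statements merged into one kernel-verified Lean document; each statement's English description precedes it below -/
import Mathlib

section
/- Let M ≥ 1 be an integer, h > 0, and b₁, …, b_M be nonzero real numbers, with r_j and D_j as in the main parametrization. Fix 1 ≤ m ≤ M, a real a_m, and a real s such that D_j(s) > 0 for all m ≤ j ≤ M + 1 and b_m − ρ(s)(1 − e^{-h}) > 0, where ρ(s) = (r_{m+1} ∘ ⋯ ∘ r_M)(s) (with ρ(s) = s when m = M). Then C_m(ρ(s)) = (D_m(s) / D_{m+1}(s))^{-a_m}, where C_m(u) = ((b_m − u(1 − e^{-h}))/b_m)^{-a_m}. -/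
open Finset Real

/-- One-step map of the control variate-based stochastic Cox–Ingersoll–Ross process
(main parametrization): `r_j(s) = s b_j e^{-h} / (b_j − s(1 − e^{-h}))`. -/
noncomputable def scirR (h : ℝ) (b : ℕ → ℝ) (j : ℕ) (s : ℝ) : ℝ :=
  s * b j * Real.exp (-h) / (b j - s * (1 - Real.exp (-h)))

/-- Denominator `D_j(s) = 1 − s(1 − e^{-h}) Σ_{l=1}^{M−j+1} e^{-(l−1)h} / b_{M−l+1}`,
with the convention `D_{M+1}(s) = 1` (empty sum). -/
noncomputable def scirD (h : ℝ) (b : ℕ → ℝ) (M j : ℕ) (s : ℝ) : ℝ :=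
  1 - s * (1 - Real.exp (-h)) *
      ∑ l ∈ Finset.Icc 1 (M + 1 - j), Real.exp (-((l : ℝ) - 1) * h) / b (M - l + 1)

/-- `iterComp r j k s = r_j (r_{j+1} (⋯ (r_{j+k-1} s)))`: the composition of `k`
consecutive one-step maps starting at index `j`, applied to `s`. -/
def iterComp (r : ℕ → ℝ → ℝ) : ℕ → ℕ → ℝ → ℝ
  | _, 0, s => s
  | j, k + 1, s => r j (iterComp r (j + 1) k s)

/-- Coefficient function `C_j(u) = ((b_j − u(1 − e^{-h}))/b_j)^{-a_j}` of the main
parametrization. -/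
noncomputable def scirC (h : ℝ) (b a : ℕ → ℝ) (j : ℕ) (u : ℝ) : ℝ :=
  ((b j - u * (1 - Real.exp (-h))) / b j) ^ (-(a j))

theorem scirD_eq_succ_sub (h : ℝ) (b : ℕ → ℝ) {M j : ℕ} (hj : 1 ≤ j) (hjM : j ≤ M) (s : ℝ) :
    scirD h b M j s = scirD h b M (j + 1) s -
      s * (1 - Real.exp (-h)) * (Real.exp (-((M - j : ℕ) : ℝ) * h) / b j) := by
  have h1 : M + 1 - j = (M - j) + 1 := by omega
  have h2 : M + 1 - (j + 1) = M - j := by omega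
  have h3 : M - (M - j + 1) + 1 = j := by omega
  unfold scirD
  rw [h1, h2, Finset.sum_Icc_succ_top (by omega), h3, Nat.cast_add_one, add_sub_cancel_right]
  ring

theorem sub_mul_one_sub_exp_eq (h : ℝ) (b : ℕ → ℝ) {M j : ℕ} (hj : 1 ≤ j) (hjM : j ≤ M)
    (hb : b j ≠ 0) (s : ℝ) (hD : scirD h b M (j + 1) s ≠ 0) :
    b j - s * Real.exp (-((M - j : ℕ) : ℝ) * h) / scirD h b M (j + 1) s *
      (1 - Real.exp (-h)) = b j * (scirD h b M j s / scirD h b M (j + 1) s) := by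
  rw [scirD_eq_succ_sub h b hj hjM]
  field_simp

theorem iterComp_scirR (h : ℝ) (b : ℕ → ℝ) (M : ℕ) (hb : ∀ j, 1 ≤ j → j ≤ M → b j ≠ 0)
    (s : ℝ) (k j : ℕ) (hj : 1 ≤ j) (hjk : j + k = M + 1)
    (hD : ∀ i, j ≤ i → i ≤ M + 1 → scirD h b M i s ≠ 0) :
    iterComp (scirR h b) j k s = s * Real.exp (-(k : ℝ) * h) / scirD h b M j s := by
  induction k generalizing j with
  | zero =>
    obtain rfl : j = M + 1 := by omega
    simp [iterComp, scirD]
  | succ k ih =>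
    have hjM : j ≤ M := by omega
    have hk : M - j = k := by omega
    have hbj := hb j hj hjM
    have hDj := hD j le_rfl (by omega)
    have hDs := hD (j + 1) (by omega) (by omega)
    have key := sub_mul_one_sub_exp_eq h b hj hjM hbj s hDs
    have hexp : Real.exp (-((k + 1 : ℕ) : ℝ) * h) =
        Real.exp (-(k : ℝ) * h) * Real.exp (-h) := by
      rw [← Real.exp_add]
      push_cast
      ring_nf
    rw [hk] at key
    rw [iterComp, ih (j + 1) (by omega) (by omega) fun i hi => hD i (by omega), scirR, key, hexp]
    field_simp

theorem scirC_eq_ratio (M : ℕ) (hM : 1 ≤ M) (h : ℝ) (hh : 0 < h) (b : ℕ → ℝ)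
    (hb : ∀ j, 1 ≤ j → j ≤ M → b j ≠ 0) (a : ℕ → ℝ)
    (m : ℕ) (hm1 : 1 ≤ m) (hm2 : m ≤ M) (s : ℝ)
    (hD : ∀ j, m ≤ j → j ≤ M + 1 → 0 < scirD h b M j s)
    (hpos : 0 < b m - iterComp (scirR h b) (m + 1) (M - m) s * (1 - Real.exp (-h))) :
    scirC h b a m (iterComp (scirR h b) (m + 1) (M - m) s) =
      (scirD h b M m s / scirD h b M (m + 1) s) ^ (-(a m)) := by
  have hbm := hb m hm1 hm2
  rw [scirC, iterComp_scirR h b M hb s (M - m) (m + 1) (by omega) (by omega)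
      fun i hi hi' => (hD i (by omega) hi').ne',
    sub_mul_one_sub_exp_eq h b hm1 hm2 hbm s (hD (m + 1) (by omega) (by omega)).ne',
    mul_div_cancel_left₀ _ hbm]
end

section
/- Let a > 0 and h > 0. Define the Markov kernel κ sending θ₀ ≥ 0 to the pushforward under w ↦ ((1 − e^{-h})/2) · w of the noncentral chi-squared distribution χ²(2a, 2θ₀ e^{-h}/(1 − e^{-h})). Then the gamma distribution Gamma(a, 1) is invariant for κ: the measure obtained by drawing θ₀ from Gamma(a, 1) and then applying κ (i.e. the bind of Gamma(a, 1) with κ) equals Gamma(a, 1). -/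
open MeasureTheory ProbabilityTheory Real

/-- The noncentral chi-squared distribution `χ²(ν, μ)`, defined as the Poisson mixture
of gamma distributions `Σ_{k} (e^{-μ/2} (μ/2)^k / k!) • Gamma(ν/2 + k, 1/2)`. -/
noncomputable def noncentralChiSq (ν μ : ℝ) : Measure ℝ :=
  Measure.sum fun k : ℕ =>
    (ENNReal.ofReal (Real.exp (-μ / 2) * (μ / 2) ^ k / (Nat.factorial k))) •
      gammaMeasure (ν / 2 + k) (1 / 2)

/-- The exact Cox–Ingersoll–Ross transition kernel over time `h` with `b = 1`,
`σ² = 2` and shape `a`, mapping a state `θ₀` to the distribution of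
`((1 − e^{-h})/2) W` with `W ~ χ²(2a, 2θ₀ e^{-h}/(1 − e^{-h}))`. -/
noncomputable def cirKernel (a h : ℝ) (θ₀ : ℝ) : Measure ℝ :=
  Measure.map (fun w => ((1 - Real.exp (-h)) / 2) * w)
    (noncentralChiSq (2 * a) (2 * θ₀ * Real.exp (-h) / (1 - Real.exp (-h))))

open scoped ENNReal Nat

lemma measurable_gammaPDF (a r : ℝ) : Measurable (gammaPDF a r) :=
  (measurable_gammaPDFReal a r).ennreal_ofReal

lemma map_const_mul_gammaMeasure (a : ℝ) {r c : ℝ} (hr : 0 ≤ r) (hc : 0 < c) :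
    (gammaMeasure a r).map (fun x => c * x) = gammaMeasure a (r / c) := by
  have hm : Measurable fun x : ℝ => c * x := measurable_const_mul c
  ext s hs
  rw [Measure.map_apply hm hs, gammaMeasure, gammaMeasure, withDensity_apply _ (hm hs),
    withDensity_apply _ hs]
  conv_rhs => rw [← Real.smul_map_volume_mul_left hc.ne']
  rw [Measure.restrict_smul, lintegral_smul_measure,
    setLIntegral_map hs (measurable_gammaPDF _ _) hm, smul_eq_mul,
    ← lintegral_const_mul' _ _ ENNReal.ofReal_ne_top]
  refine setLIntegral_congr_fun_ae (hm hs) ?_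
  filter_upwards [compl_mem_ae_iff.2 (measure_singleton (0 : ℝ))] with x hx _
  rcases lt_or_gt_of_ne (show x ≠ 0 from hx) with hx | hx
  · rw [gammaPDF_of_neg hx, gammaPDF_of_neg (mul_neg_of_pos_of_neg hc hx), mul_zero]
  · rw [gammaPDF_of_nonneg hx.le, gammaPDF_of_nonneg (by positivity), abs_of_pos hc,
      ← ENNReal.ofReal_mul hc.le, Real.div_rpow hr hc.le, Real.mul_rpow hc.le hx.le,
      Real.rpow_sub_one hc.ne', show r / c * (c * x) = r * x by field_simp]
    have := (Real.rpow_pos_of_pos hc a).ne'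
    congr 1
    field_simp

/-- The probability that a Poisson variable of mean `m` equals `k`, for real `m`. -/
noncomputable def poissonWeight (m : ℝ) (k : ℕ) : ℝ≥0∞ :=
  ENNReal.ofReal (exp (-m) * m ^ k / k !)

lemma measurable_poissonWeight (k : ℕ) : Measurable fun m => poissonWeight m k := by
  unfold poissonWeight
  fun_prop

lemma tsum_poissonWeight {m : ℝ} (hm : 0 ≤ m) : ∑' k, poissonWeight m k = 1 := by
  have h := hasSum_one_poissonMeasure ⟨m, hm⟩
  change HasSum (fun k : ℕ => exp (-m) * m ^ k / k !) 1 at h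
  unfold poissonWeight
  rw [← ENNReal.ofReal_tsum_of_nonneg (fun k => by positivity) h.summable, h.tsum_eq,
    ENNReal.ofReal_one]

lemma cirKernel_eq_sum (a : ℝ) {h : ℝ} (hh : 0 < h) (θ : ℝ) :
    cirKernel a h θ = Measure.sum fun k : ℕ =>
      poissonWeight (θ * (exp (-h) / (1 - exp (-h)))) k •
        gammaMeasure (a + k) (1 / (1 - exp (-h))) := by
  have hq : 0 < 1 - exp (-h) := by simpa using hh
  rw [cirKernel, noncentralChiSq, Measure.map_sum (by fun_prop)]
  congr 1
  ext1 k
  rw [Measure.map_smul, map_const_mul_gammaMeasure _ (by norm_num) (by positivity),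
    poissonWeight,
    show -(2 * θ * exp (-h) / (1 - exp (-h))) / 2 = -(θ * (exp (-h) / (1 - exp (-h)))) by ring,
    show 2 * θ * exp (-h) / (1 - exp (-h)) / 2 = θ * (exp (-h) / (1 - exp (-h))) by ring,
    mul_div_cancel_left₀ a two_ne_zero, div_div_div_cancel_right₀ two_ne_zero]

lemma measurable_cirKernel (a : ℝ) {h : ℝ} (hh : 0 < h) : Measurable (cirKernel a h) := by
  refine Measure.measurable_of_measurable_coe _ fun s hs => ?_
  simp only [cirKernel_eq_sum a hh, Measure.sum_apply _ hs, Measure.smul_apply, smul_eq_mul]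
  exact Measurable.tsum fun k => ((measurable_poissonWeight k).comp
    (measurable_id.mul_const _)).mul_const _

/-- Reweighting a gamma law by a Poisson likelihood gives a multiple of a gamma law. -/
lemma exists_withDensity_poissonWeight_gammaMeasure {a t r : ℝ} (ha : 0 < a) (ht : 0 ≤ t)
    (hr : 0 < r) (k : ℕ) :
    ∃ c : ℝ≥0∞, (gammaMeasure a r).withDensity (fun θ => poissonWeight (θ * t) k) =
      c • gammaMeasure (a + k) (r + t) := by
  have hw : Measurable fun θ => poissonWeight (θ * t) k :=
    (measurable_poissonWeight k).comp (measurable_id.mul_const t)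
  have hG : 0 < Gamma a := Gamma_pos_of_pos ha
  have hGk : 0 < Gamma (a + k) := Gamma_pos_of_pos (by positivity)
  refine ⟨ENNReal.ofReal (r ^ a * t ^ k * Gamma (a + k) /
    (Gamma a * k ! * (r + t) ^ (a + k))), ?_⟩
  rw [gammaMeasure, gammaMeasure, ← withDensity_mul _ (measurable_gammaPDF _ _) hw,
    ← withDensity_smul _ (measurable_gammaPDF _ _)]
  refine withDensity_congr_ae ?_
  filter_upwards [compl_mem_ae_iff.2 (measure_singleton (0 : ℝ))] with x hx
  simp only [Pi.mul_apply, Pi.smul_apply, smul_eq_mul]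
  rcases lt_or_gt_of_ne (show x ≠ 0 from hx) with hx | hx
  · simp [gammaPDF_of_neg hx]
  · have hs : 0 < (r + t) ^ (a + k) := by positivity
    rw [gammaPDF_of_nonneg hx.le, gammaPDF_of_nonneg hx.le, poissonWeight,
      ← ENNReal.ofReal_mul (by positivity), ← ENNReal.ofReal_mul (by positivity),
      show a + k - 1 = a - 1 + k by ring, Real.rpow_add_natCast hx.ne',
      show -((r + t) * x) = -(r * x) + -(x * t) by ring, exp_add, mul_pow]
    congr 1
    field_simp

/-- `Gamma(a, 1)` is invariant for the exact Cox–Ingersoll–Ross transition kernel: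
drawing `θ₀` from `Gamma(a, 1)` and applying the kernel returns `Gamma(a, 1)`. -/
theorem cirKernel_gamma_invariant (a h : ℝ) (ha : 0 < a) (hh : 0 < h) :
    (gammaMeasure a 1).bind (cirKernel a h) = gammaMeasure a 1 := by
  have hq : 0 < 1 - exp (-h) := by simpa using hh
  set t := exp (-h) / (1 - exp (-h)) with ht
  have ht0 : 0 ≤ t := by positivity
  have hrate : 1 / (1 - exp (-h)) = 1 + t := by rw [ht]; field_simp; ring
  have hw (k : ℕ) : Measurable fun θ => poissonWeight (θ * t) k :=
    (measurable_poissonWeight k).comp (measurable_id.mul_const t)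
  have hmix (k : ℕ) (s : Set ℝ) (hs : MeasurableSet s) :
      (∫⁻ θ, poissonWeight (θ * t) k ∂gammaMeasure a 1) * gammaMeasure (a + k) (1 + t) s =
        ∫⁻ θ in s, poissonWeight (θ * t) k ∂gammaMeasure a 1 := by
    obtain ⟨c, hc⟩ := exists_withDensity_poissonWeight_gammaMeasure ha ht0 one_pos k
    have := isProbabilityMeasure_gammaMeasure (a := a + k) (r := 1 + t)
      (by positivity) (by positivity)
    rw [← setLIntegral_univ, ← withDensity_apply _ .univ, ← withDensity_apply _ hs, hc]
    simp
  have hnonneg : ∀ᵐ θ ∂gammaMeasure a 1, 0 ≤ θ := by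
    rw [gammaMeasure, ae_withDensity_iff (measurable_gammaPDF a 1)]
    exact ae_of_all _ fun x hx => le_of_not_gt fun hlt => hx (gammaPDF_of_neg hlt)
  ext s hs
  rw [Measure.bind_apply hs (measurable_cirKernel a hh).aemeasurable]
  simp only [cirKernel_eq_sum a hh, Measure.sum_apply _ hs, Measure.smul_apply, smul_eq_mul,
    ← ht, hrate]
  rw [lintegral_tsum fun k => ((hw k).mul_const _).aemeasurable]
  simp only [lintegral_mul_const _ (hw _), hmix _ s hs]
  rw [← lintegral_tsum fun k => (hw k).aemeasurable, ← setLIntegral_one]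
  refine lintegral_congr_ae (ae_restrict_of_ae ?_)
  filter_upwards [hnonneg] with θ hθ
  exact tsum_poissonWeight (by positivity)
end

section
/- (Theorem 2, deterministic form.) Let M ≥ 1 be an integer, h > 0, θ₀ ≥ 0, a₁, …, a_M reals and b₁, …, b_M positive reals. With the alternative-parametrization maps r_j(s) = s b_j e^{-b_j h}/(b_j − s(1 − e^{-b_j h})), coefficients C_j(u) = ((b_j − u(1 − e^{-b_j h}))/b_j)^{-a_j}, denominators D_j(s) = 1 − s Σ_{l=1}^{M−j+1} ((1 − e^{-h b_{M−l+1}})/b_{M−l+1}) e^{-h Σ_{i=M−l+2}^{M} b_i} (D_{M+1}(s) = 1), and the recursion ρ_{M+1}(s) = s, ρ_j(s) = r_j(ρ_{j+1}(s)): for every real s such that D_j(s) > 0 for all 1 ≤ j ≤ M + 1 and b_j − ρ_{j+1}(s)(1 − e^{-b_j h}) > 0 for all 1 ≤ j ≤ M, we have exp(θ₀ ρ₁(s)) · Π_{j=1}^{M} C_j(ρ_{j+1}(s)) = exp(θ₀ s e^{-h Σ_{j=1}^{M} b_j} / D₁(s)) · Π_{m=1}^{M} (D_m(s)/D_{m+1}(s))^{-a_m}.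 -/
open Finset Real

/-- One-step map of the control variate-based stochastic Cox–Ingersoll–Ross process
(alternative parametrization): `r_j(s) = s b_j e^{-b_j h} / (b_j − s(1 − e^{-b_j h}))`. -/
noncomputable def scirRAlt (h : ℝ) (b : ℕ → ℝ) (j : ℕ) (s : ℝ) : ℝ :=
  s * b j * Real.exp (-(b j) * h) / (b j - s * (1 - Real.exp (-(b j) * h)))

/-- Denominator of the alternative parametrization:
`D_j(s) = 1 − s Σ_{l=1}^{M−j+1} ((1 − e^{-h b_{M−l+1}})/b_{M−l+1}) e^{-h Σ_{i=M−l+2}^{M} b_i}`,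
with the convention `D_{M+1}(s) = 1` (empty sum), the inner exponent sum being empty
when `l = 1`. -/
noncomputable def scirDAlt (h : ℝ) (b : ℕ → ℝ) (M j : ℕ) (s : ℝ) : ℝ :=
  1 - s * ∑ l ∈ Finset.Icc 1 (M + 1 - j),
      ((1 - Real.exp (-h * b (M - l + 1))) / b (M - l + 1)) *
        Real.exp (-h * ∑ i ∈ Finset.Icc (M - l + 2) M, b i)

/-- Coefficient function `C_j(u) = ((b_j − u(1 − e^{-b_j h}))/b_j)^{-a_j}` of the
alternative parametrization. -/
noncomputable def scirCAlt (h : ℝ) (b a : ℕ → ℝ) (j : ℕ) (u : ℝ) : ℝ :=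
  ((b j - u * (1 - Real.exp (-(b j) * h))) / b j) ^ (-(a j))

theorem scirDAlt_succ_self (h : ℝ) (b : ℕ → ℝ) (M : ℕ) (s : ℝ) :
    scirDAlt h b M (M + 1) s = 1 := by
  simp [scirDAlt]

theorem scirDAlt_eq_succ_sub (h : ℝ) (b : ℕ → ℝ) {M j : ℕ} (hj : 1 ≤ j) (hjM : j ≤ M) (s : ℝ) :
    scirDAlt h b M j s = scirDAlt h b M (j + 1) s -
      s * (((1 - Real.exp (-(b j) * h)) / b j) *
        Real.exp (-h * ∑ i ∈ Finset.Icc (j + 1) M, b i)) := by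
  unfold scirDAlt
  rw [show M + 1 - j = (M - j) + 1 by omega, show M + 1 - (j + 1) = M - j by omega,
    Finset.sum_Icc_succ_top (by omega), show M - (M - j + 1) + 1 = j by omega,
    show M - (M - j + 1) + 2 = j + 1 by omega, show -h * b j = -(b j) * h by ring]
  ring

theorem sub_mul_eq_mul_scirDAlt_div {h : ℝ} {b : ℕ → ℝ} {M j : ℕ} (hj : 1 ≤ j) (hjM : j ≤ M)
    {s : ℝ} (hb : b j ≠ 0) (hD : scirDAlt h b M (j + 1) s ≠ 0) :
    b j - s * Real.exp (-h * ∑ i ∈ Finset.Icc (j + 1) M, b i) / scirDAlt h b M (j + 1) s *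
        (1 - Real.exp (-(b j) * h)) =
      b j * (scirDAlt h b M j s / scirDAlt h b M (j + 1) s) := by
  rw [scirDAlt_eq_succ_sub h b hj hjM]
  field_simp

/-- Closed form `ρ_j(s) = s e^{-h Σ_{i=j}^M b_i} / D_j(s)` of the composed one-step maps. -/
theorem iterComp_scirRAlt {h : ℝ} {b : ℕ → ℝ} {M : ℕ} {s : ℝ}
    (hb : ∀ j, 1 ≤ j → j ≤ M → b j ≠ 0)
    (hD : ∀ j, 1 ≤ j → j ≤ M + 1 → scirDAlt h b M j s ≠ 0) {j k : ℕ} (hj : 1 ≤ j)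
    (hjk : j + k = M + 1) :
    iterComp (scirRAlt h b) j k s =
      s * Real.exp (-h * ∑ i ∈ Finset.Icc j M, b i) / scirDAlt h b M j s := by
  induction k generalizing j with
  | zero =>
    obtain rfl : j = M + 1 := by omega
    simp [iterComp, scirDAlt_succ_self]
  | succ k ih =>
    have hjM : j ≤ M := by omega
    have hbj := hb j hj hjM
    have hDj := hD j hj (by omega)
    have hDj' := hD (j + 1) (by omega) (by omega)
    have hexp : Real.exp (-h * ∑ i ∈ Finset.Icc j M, b i) =
        Real.exp (-(b j) * h) * Real.exp (-h * ∑ i ∈ Finset.Icc (j + 1) M, b i) := by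
      rw [← Real.exp_add, ← Finset.add_sum_Ioc_eq_sum_Icc hjM, ← Finset.Icc_add_one_left_eq_Ioc]
      ring_nf
    rw [iterComp, ih (by omega) (by omega), scirRAlt,
      sub_mul_eq_mul_scirDAlt_div hj hjM hbj hDj', hexp]
    field_simp

/-- Theorem 2 (deterministic form): the `M`-step chained moment-generating function
of the control variate-based stochastic Cox–Ingersoll–Ross process, alternative
parametrization.  Here `ρ_j(s) = iterComp (scirRAlt h b) j (M + 1 - j) s` satisfies
`ρ_{M+1}(s) = s`, `ρ_j(s) = r_j(ρ_{j+1}(s))`. -/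
theorem scirCV_alt_mgf_M_steps (M : ℕ) (hM : 1 ≤ M) (h θ₀ : ℝ) (hh : 0 < h) (hθ : 0 ≤ θ₀)
    (a b : ℕ → ℝ) (hb : ∀ j, 1 ≤ j → j ≤ M → 0 < b j) (s : ℝ)
    (hD : ∀ j, 1 ≤ j → j ≤ M + 1 → 0 < scirDAlt h b M j s)
    (hpos : ∀ j, 1 ≤ j → j ≤ M →
      0 < b j - iterComp (scirRAlt h b) (j + 1) (M - j) s * (1 - Real.exp (-(b j) * h))) :
    Real.exp (θ₀ * iterComp (scirRAlt h b) 1 M s) *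
        ∏ j ∈ Finset.Icc 1 M, scirCAlt h b a j (iterComp (scirRAlt h b) (j + 1) (M - j) s) =
      Real.exp (θ₀ * s * Real.exp (-h * ∑ j ∈ Finset.Icc 1 M, b j) / scirDAlt h b M 1 s) *
        ∏ m ∈ Finset.Icc 1 M, (scirDAlt h b M m s / scirDAlt h b M (m + 1) s) ^ (-(a m)) := by
  have hb' : ∀ j, 1 ≤ j → j ≤ M → b j ≠ 0 := fun j h₁ h₂ => (hb j h₁ h₂).ne'
  have hD' : ∀ j, 1 ≤ j → j ≤ M + 1 → scirDAlt h b M j s ≠ 0 := fun j h₁ h₂ => (hD j h₁ h₂).ne'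
  congr 1
  · rw [iterComp_scirRAlt hb' hD' le_rfl (by omega)]
    ring_nf
  · refine Finset.prod_congr rfl fun j hj => ?_
    obtain ⟨hj₁, hjM⟩ := Finset.mem_Icc.mp hj
    rw [scirCAlt, iterComp_scirRAlt hb' hD' (by omega) (by omega),
      sub_mul_eq_mul_scirDAlt_div hj₁ hjM (hb' j hj₁ hjM) (hD' (j + 1) (by omega) (by omega)),
      mul_div_cancel_left₀ _ (hb' j hj₁ hjM)]
end

section
/- Let M ≥ 1 be an integer, h > 0, θ₀ ≥ 0, a₁, …, a_M reals and b₁, …, b_M positive reals, with the alternative-parametrization r_j, D_j, ρ_j. Then the cumulant function K(s) = θ₀ ρ₁(s) − Σ_{m=1}^{M} a_m · log(D_m(s)/D_{m+1}(s)) has derivative at s = 0 equal to K′(0) = θ₀ e^{-h Σ_{j=1}^{M} b_j} + Σ_{m=1}^{M} (a_m (1 − e^{-h b_m}) / b_m) · e^{-h Σ_{j=m+1}^{M} b_j} (where the sum Σ_{j=m+1}^{M} b_j is empty for m = M). -/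
open Finset Real

/-- Cumulant function `K(s) = θ₀ ρ₁(s) − Σ_{m=1}^{M} a_m log(D_m(s)/D_{m+1}(s))`
of the `M`-step control variate-based stochastic Cox–Ingersoll–Ross process
(alternative parametrization), where `ρ₁ = r₁ ∘ ⋯ ∘ r_M`. -/
noncomputable def scirKAlt (h θ₀ : ℝ) (a b : ℕ → ℝ) (M : ℕ) (s : ℝ) : ℝ :=
  θ₀ * iterComp (scirRAlt h b) 1 M s -
    ∑ m ∈ Finset.Icc 1 M, a m * Real.log (scirDAlt h b M m s / scirDAlt h b M (m + 1) s)

theorem hasDerivAt_scirRAlt_zero (h : ℝ) (b : ℕ → ℝ) (j : ℕ) (hb : b j ≠ 0) :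
    HasDerivAt (scirRAlt h b j) (Real.exp (-h * b j)) 0 := by
  have hnum : HasDerivAt (fun s : ℝ => s * b j * Real.exp (-(b j) * h))
      (1 * b j * Real.exp (-(b j) * h)) 0 :=
    ((hasDerivAt_id (0 : ℝ)).mul_const _).mul_const _
  have hden : HasDerivAt (fun s : ℝ => b j - s * (1 - Real.exp (-(b j) * h)))
      (-(1 * (1 - Real.exp (-(b j) * h)))) 0 :=
    ((hasDerivAt_id (0 : ℝ)).mul_const _).const_sub _
  refine (hnum.div hden (by simpa using hb)).congr_deriv ?_
  rw [show -h * b j = -(b j) * h by ring]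
  simp only [zero_mul, sub_zero, one_mul]
  field_simp

theorem iterComp_zero {r : ℕ → ℝ → ℝ} (hr : ∀ i, r i 0 = 0) (j k : ℕ) :
    iterComp r j k 0 = 0 := by
  induction k generalizing j with
  | zero => rfl
  | succ k ih => rw [iterComp, ih, hr]

theorem hasDerivAt_iterComp_zero {r : ℕ → ℝ → ℝ} {d : ℕ → ℝ} (hr : ∀ i, r i 0 = 0) (j k : ℕ)
    (hd : ∀ i ∈ Finset.Ico j (j + k), HasDerivAt (r i) (d i) 0) :
    HasDerivAt (iterComp r j k) (∏ i ∈ Finset.Ico j (j + k), d i) 0 := by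
  induction k generalizing j with
  | zero => simpa [iterComp] using hasDerivAt_id' (0 : ℝ)
  | succ k ih =>
    have hlt : j < j + (k + 1) := by omega
    have hidx : j + 1 + k = j + (k + 1) := by omega
    have htail : HasDerivAt (iterComp r (j + 1) k) (∏ i ∈ Finset.Ico (j + 1) (j + (k + 1)), d i) 0 :=
      hidx ▸ ih (j + 1) fun i hi => hd i (by simp only [Finset.mem_Ico] at hi ⊢; omega)
    rw [Finset.prod_eq_prod_Ico_succ_bot hlt]
    exact HasDerivAt.comp_of_eq 0 (hd j (by simp)) htail (iterComp_zero hr _ _).symm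

theorem hasDerivAt_log_scirDAlt_div_zero (h : ℝ) (b : ℕ → ℝ) {M m : ℕ} (hm : 1 ≤ m)
    (hmM : m ≤ M) :
    HasDerivAt (fun s => Real.log (scirDAlt h b M m s / scirDAlt h b M (m + 1) s))
      (-((1 - Real.exp (-h * b m)) / b m * Real.exp (-h * ∑ j ∈ Finset.Icc (m + 1) M, b j))) 0 := by
  have hzero (j : ℕ) : scirDAlt h b M j 0 = 1 := by simp [scirDAlt]
  have hD (j : ℕ) := ((hasDerivAt_id (0 : ℝ)).mul_const
    (∑ l ∈ Finset.Icc 1 (M + 1 - j), ((1 - Real.exp (-h * b (M - l + 1))) / b (M - l + 1)) *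
      Real.exp (-h * ∑ i ∈ Finset.Icc (M - l + 2) M, b i))).const_sub 1
  have hD' (j : ℕ) : HasDerivAt (scirDAlt h b M j) _ 0 := hD j
  refine (((hD' m).div (hD' (m + 1)) (by simp [hzero])).log (by simp [hzero])).congr_deriv ?_
  simp only [Pi.div_apply, hzero]
  rw [show M + 1 - m = M - m + 1 by omega, show M + 1 - (m + 1) = M - m by omega,
    Finset.sum_Icc_succ_top (by omega), show M - (M - m + 1) + 1 = m by omega,
    show M - (M - m + 1) + 2 = m + 1 by omega]
  ring

theorem scirKAlt_hasDerivAt_zero (M : ℕ) (hM : 1 ≤ M) (h θ₀ : ℝ) (hh : 0 < h)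
    (hθ : 0 ≤ θ₀) (a b : ℕ → ℝ) (hb : ∀ j, 1 ≤ j → j ≤ M → 0 < b j) :
    HasDerivAt (scirKAlt h θ₀ a b M)
      (θ₀ * Real.exp (-h * ∑ j ∈ Finset.Icc 1 M, b j) +
        ∑ m ∈ Finset.Icc 1 M,
          (a m * (1 - Real.exp (-h * b m)) / b m) *
            Real.exp (-h * ∑ j ∈ Finset.Icc (m + 1) M, b j)) 0 := by
  have hiter := hasDerivAt_iterComp_zero (r := scirRAlt h b) (d := fun i => Real.exp (-h * b i))
    (fun i => by simp [scirRAlt]) 1 M fun i hi => by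
      rw [Finset.mem_Ico] at hi
      exact hasDerivAt_scirRAlt_zero h b i (hb i hi.1 (by omega)).ne'
  have hprod : ∏ i ∈ Finset.Ico 1 (1 + M), Real.exp (-h * b i) =
      Real.exp (-h * ∑ j ∈ Finset.Icc 1 M, b j) := by
    rw [← Real.exp_sum, ← Finset.mul_sum, add_comm 1 M, Finset.Ico_add_one_right_eq_Icc]
  rw [hprod] at hiter
  have hlog := HasDerivAt.fun_sum fun m (hm : m ∈ Finset.Icc 1 M) =>
    (hasDerivAt_log_scirDAlt_div_zero h b (Finset.mem_Icc.1 hm).1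
      (Finset.mem_Icc.1 hm).2).const_mul (a m)
  refine ((hiter.const_mul θ₀).sub hlog).congr_deriv ?_
  rw [sub_eq_add_neg, ← Finset.sum_neg_distrib]
  congr 1
  exact Finset.sum_congr rfl fun m _ => by ring
end
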